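/- arXiv:1802.05111 — 3 statements merged into one kernel-verified Lean document; each statement's English description precedes it below -/
import Mathlib

section
/- For every ε > 0 there exists a constant C_ε > 0 such that for all reals P, L, R ≥ 1, the sum over primes p₁, p₂ ∈ [P,2P], primes ℓ₁, ℓ₂ ∈ [L,2L], and positive integers r₁, r₂ ∈ [R,2R], restricted to those tuples with ℓ₁ r₂ p₂ ≠ ℓ₂ r₁ p₁, of 1/|ℓ₁ r₂ p₂ − ℓ₂ r₁ p₁|, is at most C_ε ( (LPR)^{1+ε} + min{L, P, R}^{2+ε} ). -/
/-- The number of prime factors of `m ≠ 0` is at most the binary logarithm of `m`. -/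
theorem Nat.card_primeFactors_le_log_two {m : ℕ} (hm : m ≠ 0) :
    m.primeFactors.card ≤ Nat.log 2 m := by
  apply Nat.le_log_of_pow_le one_lt_two
  calc 2 ^ m.primeFactors.card ≤ ∏ p ∈ m.primeFactors, p :=
        Finset.pow_card_le_prod _ _ _ fun p hp => (Nat.prime_of_mem_primeFactors hp).two_le
    _ ≤ m := Nat.le_of_dvd (Nat.pos_of_ne_zero hm) (Nat.prod_primeFactors_dvd m)

/-- A nonzero integer has few factorizations `ℓ * r * p` with `ℓ` and `p` prime. -/
theorem card_filter_prime_mul_mul_prime_eq_le (A B T : Finset ℕ) {m : ℕ} (hm : m ≠ 0) :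
    ((A.filter Nat.Prime ×ˢ B.filter Nat.Prime ×ˢ T).filter
      fun t => t.2.1 * t.2.2 * t.1 = m).card ≤ Nat.log 2 m ^ 2 := by
  calc _ ≤ (m.primeFactors ×ˢ m.primeFactors).card := by
        refine Finset.card_le_card_of_injOn (fun t => (t.1, t.2.1)) ?_ ?_
        · rintro ⟨p, l, r⟩ h
          simp only [Finset.coe_filter, Finset.mem_product, Finset.mem_filter,
            Set.mem_ofPred_eq] at h
          obtain ⟨⟨⟨-, hp⟩, ⟨-, hl⟩, -⟩, h⟩ := h
          simp only [Finset.coe_product, Set.mem_prod, Finset.mem_coe, Nat.mem_primeFactors]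
          exact ⟨⟨hp, ⟨l * r, by rw [← h]; ring⟩, hm⟩, hl, ⟨r * p, by rw [← h]; ring⟩, hm⟩
        · rintro ⟨p, l, r⟩ h ⟨p', l', r'⟩ h' e
          simp only [Finset.coe_filter, Finset.mem_product, Finset.mem_filter,
            Set.mem_ofPred_eq] at h h'
          obtain ⟨⟨⟨-, hp⟩, ⟨-, hl⟩, -⟩, h⟩ := h
          obtain ⟨-, h'⟩ := h'
          obtain ⟨rfl, rfl⟩ := Prod.mk.inj e
          rw [← h] at h'
          have := Nat.eq_of_mul_eq_mul_left hl.pos (Nat.eq_of_mul_eq_mul_right hp.pos h')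
          rw [this]
    _ ≤ Nat.log 2 m ^ 2 := by
        rw [Finset.card_product, sq]
        exact Nat.mul_le_mul (Nat.card_primeFactors_le_log_two hm)
          (Nat.card_primeFactors_le_log_two hm)

theorem sum_one_div_le_one_add_log_of_injOn {M : ℕ} (s : Finset ℕ) (g : ℕ → ℕ)
    (hg : Set.InjOn g s) (hs : ∀ m ∈ s, g m ∈ Finset.Icc 1 M) :
    ∑ m ∈ s, (1 : ℝ) / (g m : ℝ) ≤ 1 + Real.log M := by
  calc ∑ m ∈ s, (1 : ℝ) / (g m : ℝ) = ∑ k ∈ s.image g, (1 : ℝ) / (k : ℝ) :=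
        (Finset.sum_image (f := fun k : ℕ => (1 : ℝ) / (k : ℝ)) hg).symm
    _ ≤ ∑ k ∈ Finset.Icc 1 M, (1 : ℝ) / (k : ℝ) :=
        Finset.sum_le_sum_of_subset_of_nonneg (Finset.image_subset_iff.2 hs)
          fun _ _ _ => by positivity
    _ = (harmonic M : ℝ) := by
        rw [harmonic_eq_sum_Icc]
        push_cast
        simp
    _ ≤ 1 + Real.log M := harmonic_le_one_add_log M

theorem sum_Icc_one_div_abs_sub_le {a M : ℕ} (haM : a ≤ M) :
    ∑ m ∈ Finset.Icc 1 M, (if a = m then (0 : ℝ) else 1 / |(a : ℝ) - m|)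
      ≤ 2 * (1 + Real.log M) := by
  have h₁ := sum_one_div_le_one_add_log_of_injOn (M := M)
    ((Finset.Icc 1 M).filter (· < a)) (a - ·)
    (by intro x hx y hy h; simp at hx hy h; omega)
    (by intro m hm; simp at hm ⊢; omega)
  have h₂ := sum_one_div_le_one_add_log_of_injOn (M := M)
    ((Finset.Icc 1 M).filter (a < ·)) (· - a)
    (by intro x hx y hy h; simp at hx hy h; omega)
    (by intro m hm; simp at hm ⊢; omega)
  rw [Finset.sum_filter] at h₁ h₂
  calc _ = ∑ m ∈ Finset.Icc 1 M, ((if m < a then (1 : ℝ) / ((a - m : ℕ) : ℝ) else 0) +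
        (if a < m then (1 : ℝ) / ((m - a : ℕ) : ℝ) else 0)) := by
        refine Finset.sum_congr rfl fun m _ => ?_
        rcases lt_trichotomy a m with h | rfl | h
        · have : (a : ℝ) < m := by exact_mod_cast h
          rw [if_neg h.ne, if_neg h.not_gt, if_pos h, Nat.cast_sub h.le,
            abs_of_neg (by linarith), neg_sub, zero_add]
        · simp
        · have : (m : ℝ) < a := by exact_mod_cast h
          rw [if_neg h.ne', if_pos h, if_neg h.not_gt, Nat.cast_sub h.le,
            abs_of_pos (by linarith), add_zero]
    _ ≤ 2 * (1 + Real.log M) := by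
        rw [Finset.sum_add_distrib]
        linarith

/-- If `φ` takes every value at most `K` times on `S`, with all values in `[1, M]`, then the sum of
`1 / |φ t - φ s|` over pairs with `φ t ≠ φ s` is at most `2 K |S| (1 + log M)`. -/
theorem sum_sum_one_div_abs_sub_le {ι : Type*} (S : Finset ι) (φ : ι → ℕ) {M K : ℕ}
    (hφ : ∀ t ∈ S, φ t ∈ Finset.Icc 1 M)
    (hK : ∀ m ∈ Finset.Icc 1 M, (S.filter (φ · = m)).card ≤ K) :
    ∑ t ∈ S, ∑ s ∈ S, (if φ t = φ s then (0 : ℝ) else 1 / |(φ t : ℝ) - φ s|)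
      ≤ S.card * (K * (2 * (1 + Real.log M))) := by
  rw [← nsmul_eq_mul]
  refine Finset.sum_le_card_nsmul _ _ _ fun t ht => ?_
  calc _ = ∑ m ∈ Finset.Icc 1 M, ∑ s ∈ S.filter (φ · = m),
          (if φ t = φ s then (0 : ℝ) else 1 / |(φ t : ℝ) - φ s|) :=
        (Finset.sum_fiberwise_of_maps_to hφ _).symm
    _ ≤ ∑ m ∈ Finset.Icc 1 M, K * (if φ t = m then (0 : ℝ) else 1 / |(φ t : ℝ) - m|) := by
        refine Finset.sum_le_sum fun m hm => ?_
        calc _ = ∑ s ∈ S.filter (φ · = m),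
              (if φ t = m then (0 : ℝ) else 1 / |(φ t : ℝ) - m|) :=
              Finset.sum_congr rfl fun s hs => by rw [(Finset.mem_filter.1 hs).2]
          _ ≤ _ := by
              rw [Finset.sum_const, nsmul_eq_mul]
              refine mul_le_mul_of_nonneg_right (by exact_mod_cast hK m hm) ?_
              split_ifs <;> positivity
    _ ≤ K * (2 * (1 + Real.log M)) := by
        rw [← Finset.mul_sum]
        exact mul_le_mul_of_nonneg_left
          (sum_Icc_one_div_abs_sub_le (Finset.mem_Icc.1 (hφ t ht)).2) K.cast_nonneg

theorem card_Icc_ceil_floor_two_mul_le {X : ℝ} (hX : 1 ≤ X) :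
    ((Finset.Icc ⌈X⌉₊ ⌊2 * X⌋₊).card : ℝ) ≤ 2 * X := by
  have h : (Finset.Icc ⌈X⌉₊ ⌊2 * X⌋₊).card ≤ ⌊2 * X⌋₊ := by
    have : 0 < ⌈X⌉₊ := Nat.ceil_pos.2 (by linarith)
    rw [Nat.card_Icc]
    omega
  exact (Nat.cast_le.2 h).trans (Nat.floor_le (by linarith))

theorem one_add_log_le_mul_rpow {x δ : ℝ} (hx : 1 ≤ x) (hδ : 0 < δ) :
    1 + Real.log x ≤ (1 + 1 / δ) * x ^ δ := by
  have h₁ := Real.log_le_rpow_div (by linarith : 0 ≤ x) hδ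
  have h₂ := Real.one_le_rpow hx hδ.le
  calc 1 + Real.log x ≤ x ^ δ + x ^ δ / δ := add_le_add h₂ h₁
    _ = _ := by ring

theorem natLog_two_le_two_mul_one_add_log {M : ℕ} {x : ℝ} (hM : 0 < M) (hx : (M : ℝ) ≤ x) :
    (Nat.log 2 M : ℝ) ≤ 2 * (1 + Real.log x) := by
  have hM' : (1 : ℝ) ≤ M := by exact_mod_cast hM
  have h₁ : (Nat.log 2 M : ℝ) * Real.log 2 ≤ Real.log x := by
    rw [← Real.log_pow]
    refine Real.log_le_log (by positivity) (le_trans ?_ hx)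
    exact_mod_cast Nat.pow_log_le_self 2 hM.ne'
  have h₂ := Real.log_two_gt_d9
  have h₃ : (0 : ℝ) ≤ Nat.log 2 M := Nat.cast_nonneg _
  nlinarith

/-- For every `ε > 0` there is a constant `C_ε > 0` such that for all reals
`P, L, R ≥ 1`, the sum over primes `p₁, p₂ ∈ [P,2P]`, primes `ℓ₁, ℓ₂ ∈ [L,2L]` and positive
integers `r₁, r₂ ∈ [R,2R]` with `ℓ₁ r₂ p₂ ≠ ℓ₂ r₁ p₁` of `1/|ℓ₁ r₂ p₂ − ℓ₂ r₁ p₁|` is at most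
`C_ε ((LPR)^{1+ε} + min{L,P,R}^{2+ε})`. -/
theorem statement1 :
    ∀ ε : ℝ, 0 < ε → ∃ C : ℝ, 0 < C ∧
      ∀ P L R : ℝ, 1 ≤ P → 1 ≤ L → 1 ≤ R →
        (∑ p₁ ∈ (Finset.Icc ⌈P⌉₊ ⌊2 * P⌋₊).filter Nat.Prime,
         ∑ p₂ ∈ (Finset.Icc ⌈P⌉₊ ⌊2 * P⌋₊).filter Nat.Prime,
         ∑ ℓ₁ ∈ (Finset.Icc ⌈L⌉₊ ⌊2 * L⌋₊).filter Nat.Prime,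
         ∑ ℓ₂ ∈ (Finset.Icc ⌈L⌉₊ ⌊2 * L⌋₊).filter Nat.Prime,
         ∑ r₁ ∈ Finset.Icc ⌈R⌉₊ ⌊2 * R⌋₊,
         ∑ r₂ ∈ Finset.Icc ⌈R⌉₊ ⌊2 * R⌋₊,
           if ℓ₁ * r₂ * p₂ = ℓ₂ * r₁ * p₁ then (0 : ℝ)
           else 1 / |(ℓ₁ * r₂ * p₂ : ℝ) - (ℓ₂ * r₁ * p₁ : ℝ)|)
        ≤ C * ((L * P * R) ^ (1 + ε) + (min L (min P R)) ^ (2 + ε)) := by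
  intro ε hε
  refine ⟨64 * (1 + 1 / (ε / 3)) ^ 3 * 8 ^ ε, by positivity, fun P L R hP hL hR => ?_⟩
  set A := Finset.Icc ⌈P⌉₊ ⌊2 * P⌋₊ with hA
  set B := Finset.Icc ⌈L⌉₊ ⌊2 * L⌋₊ with hB
  set T := Finset.Icc ⌈R⌉₊ ⌊2 * R⌋₊ with hT
  set S := A.filter Nat.Prime ×ˢ B.filter Nat.Prime ×ˢ T with hS
  set φ : ℕ × ℕ × ℕ → ℕ := fun t => t.2.1 * t.2.2 * t.1 with hφdef
  set N := L * P * R with hN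
  have hN1 : 1 ≤ N := one_le_mul_of_one_le_of_one_le (one_le_mul_of_one_le_of_one_le hL hP) hR
  set M := ⌊8 * N⌋₊ with hM
  have hMN : (M : ℝ) ≤ 8 * N := Nat.floor_le (by linarith)
  have hM0 : 0 < M := Nat.floor_pos.2 (by linarith)
  have hφ : ∀ t ∈ S, φ t ∈ Finset.Icc 1 M := by
    rintro ⟨p, l, r⟩ ht
    simp only [hS, hA, hB, hT, Finset.mem_product, Finset.mem_filter, Finset.mem_Icc] at ht
    obtain ⟨⟨⟨-, hp⟩, hp'⟩, ⟨⟨-, hl⟩, hl'⟩, hr', hr⟩ := ht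
    have hr0 : 0 < r := (Nat.ceil_pos.2 (by linarith)).trans_le hr'
    refine Finset.mem_Icc.2 ⟨Nat.mul_pos (Nat.mul_pos hl'.pos hr0) hp'.pos, Nat.le_floor ?_⟩
    have hp2 := (Nat.le_floor_iff (by linarith : 0 ≤ 2 * P)).1 hp
    have hl2 := (Nat.le_floor_iff (by linarith : 0 ≤ 2 * L)).1 hl
    have hr2 := (Nat.le_floor_iff (by linarith : 0 ≤ 2 * R)).1 hr
    push_cast [hφdef]
    calc (l : ℝ) * r * p ≤ (2 * L) * (2 * R) * (2 * P) := by gcongr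
      _ = 8 * N := by rw [hN]; ring
  have hK : ∀ m ∈ Finset.Icc 1 M, (S.filter (φ · = m)).card ≤ Nat.log 2 M ^ 2 := by
    intro m hm
    obtain ⟨hm1, hmM⟩ := Finset.mem_Icc.1 hm
    exact (card_filter_prime_mul_mul_prime_eq_le A B T (by omega)).trans
      (Nat.pow_le_pow_left (Nat.log_mono_right hmM) 2)
  have hcard : (S.card : ℝ) ≤ 8 * N := by
    have h₁ := card_Icc_ceil_floor_two_mul_le hP
    have h₂ := card_Icc_ceil_floor_two_mul_le hL
    have h₃ := card_Icc_ceil_floor_two_mul_le hR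
    have h₄ : ((A.filter Nat.Prime).card : ℝ) ≤ 2 * P :=
      (Nat.cast_le.2 (Finset.card_filter_le _ _)).trans h₁
    have h₅ : ((B.filter Nat.Prime).card : ℝ) ≤ 2 * L :=
      (Nat.cast_le.2 (Finset.card_filter_le _ _)).trans h₂
    rw [hS, Finset.card_product, Finset.card_product]
    push_cast
    calc _ ≤ (2 * P) * ((2 * L) * (2 * R)) := by gcongr
      _ = 8 * N := by rw [hN]; ring
  have hlogM : Real.log M ≤ Real.log (8 * N) :=
    Real.log_le_log (by exact_mod_cast hM0) hMN
  have hlog0 : 0 ≤ Real.log (8 * N) := Real.log_nonneg (by linarith)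
  calc _ = ∑ t ∈ S, ∑ s ∈ S, (if φ t = φ s then (0 : ℝ) else 1 / |(φ t : ℝ) - φ s|) := by
        simp only [hS, Finset.sum_product, hφdef]
        push_cast
        rw [Finset.sum_comm]
        refine Finset.sum_congr rfl fun p₂ _ => ?_
        rw [Finset.sum_comm]
        refine Finset.sum_congr rfl fun l₁ _ => ?_
        symm
        rw [Finset.sum_comm]
        refine Finset.sum_congr rfl fun p₁ _ => ?_
        rw [Finset.sum_comm]
        exact Finset.sum_congr rfl fun l₂ _ => Finset.sum_comm
    _ ≤ S.card * ((Nat.log 2 M ^ 2 : ℕ) * (2 * (1 + Real.log M))) :=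
        sum_sum_one_div_abs_sub_le S φ hφ hK
    _ ≤ (8 * N) * ((2 * (1 + Real.log (8 * N))) ^ 2 * (2 * (1 + Real.log (8 * N)))) := by
        push_cast
        have := natLog_two_le_two_mul_one_add_log hM0 hMN
        gcongr
    _ = 64 * N * (1 + Real.log (8 * N)) ^ 3 := by ring
    _ ≤ 64 * N * ((1 + 1 / (ε / 3)) * (8 * N) ^ (ε / 3)) ^ 3 := by
        have := one_add_log_le_mul_rpow (by linarith : 1 ≤ 8 * N) (by positivity : 0 < ε / 3)
        gcongr
    _ = 64 * (1 + 1 / (ε / 3)) ^ 3 * 8 ^ ε * N ^ (1 + ε) := by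
        have h : ((8 * N) ^ (ε / 3)) ^ 3 = 8 ^ ε * N ^ ε := by
          rw [← Real.rpow_natCast, ← Real.rpow_mul (by linarith),
            ← Real.mul_rpow (by norm_num) (by linarith)]
          congr 1
          push_cast
          ring
        rw [mul_pow, h, Real.rpow_add (by linarith), Real.rpow_one]
        ring
    _ ≤ _ := by
        refine mul_le_mul_of_nonneg_left (le_add_of_nonneg_right ?_) (by positivity)
        exact Real.rpow_nonneg (le_min (by linarith) (le_min (by linarith) (by linarith))) _
end

section
/- For every ε > 0 there exists a constant C_ε > 0 such that for all reals P, L, R ≥ 1 and every positive integer M, the sum over primes p₁, p₂ ∈ [P,2P], primes ℓ₁, ℓ₂ ∈ [L,2L], and positive integers r₁, r₂ ∈ [R,2R], restricted to those tuples with ℓ₁ r₂ p₂ ≠ ℓ₂ r₁ p₁ and ℓ₁ r₂ p₂ ≡ ℓ₂ r₁ p₁ (mod M), of 1/|r₁ p₁ ℓ₂ − r₂ p₂ ℓ₁|, is at most C_ε ( (LPR)^{1+ε}/M + min{L, P, R}^{2+ε}/M ). -/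
open Finset in
/-- A sum of a nonnegative function over products `r * p * l` with `p`, `l` prime is at most the sum
over all integers up to `X`, times the square of a bound for the number of prime factors. -/
lemma sum_prime_prime_mul_le (A B D : Finset ℕ) (X : ℕ) (hA : ∀ p ∈ A, p.Prime)
    (hB : ∀ l ∈ B, l.Prime) (hX : ∀ p ∈ A, ∀ l ∈ B, ∀ r ∈ D, r * p * l ∈ Icc 1 X)
    (h : ℕ → ℝ) (hh : ∀ n, 0 ≤ h n) :
    ∑ p ∈ A, ∑ l ∈ B, ∑ r ∈ D, h (r * p * l) ≤ (Nat.log 2 X : ℝ) ^ 2 * ∑ n ∈ Icc 1 X, h n := by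
  have hmaps : ∀ x ∈ A ×ˢ B ×ˢ D, x.2.2 * x.1 * x.2.1 ∈ Icc 1 X := by
    rintro ⟨p, l, r⟩ hx
    simp only [mem_product] at hx
    exact hX p hx.1 l hx.2.1 r hx.2.2
  have hsum : ∑ p ∈ A, ∑ l ∈ B, ∑ r ∈ D, h (r * p * l) =
      ∑ x ∈ A ×ˢ B ×ˢ D, h (x.2.2 * x.1 * x.2.1) := by
    simp only [sum_product]
  rw [hsum, ← sum_fiberwise_of_maps_to hmaps, mul_sum]
  refine sum_le_sum fun n hn => ?_
  have hn' := mem_Icc.mp hn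
  have hn0 : n ≠ 0 := by omega
  rw [sum_congr rfl (g := fun _ => h n) (fun x hx => by rw [(mem_filter.mp hx).2]),
    sum_const, nsmul_eq_mul]
  refine mul_le_mul_of_nonneg_right ?_ (hh n)
  have hω : n.primeFactors.card ≤ Nat.log 2 X := by
    refine Nat.le_log_of_pow_le one_lt_two (le_trans ?_ hn'.2)
    calc 2 ^ n.primeFactors.card ≤ ∏ p ∈ n.primeFactors, p :=
          pow_card_le_prod _ _ _ fun p hp => (Nat.prime_of_mem_primeFactors hp).two_le
      _ ≤ n := Nat.le_of_dvd hn'.1 (Nat.prod_primeFactors_dvd n)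
  have hcard : ((A ×ˢ B ×ˢ D).filter fun x => x.2.2 * x.1 * x.2.1 = n).card ≤
      (n.primeFactors ×ˢ n.primeFactors).card := by
    refine card_le_card_of_injOn (fun x => (x.1, x.2.1)) ?_ ?_
    · rintro ⟨p, l, r⟩ hx
      simp only [coe_filter, mem_product, Set.mem_ofPred_eq] at hx
      obtain ⟨⟨hp, hl, -⟩, rfl⟩ := hx
      simp only [coe_product, Set.mem_prod, mem_coe, Nat.mem_primeFactors]
      exact ⟨⟨hA p hp, ⟨r * l, by ring⟩, hn0⟩, ⟨hB l hl, ⟨r * p, by ring⟩, hn0⟩⟩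
    · rintro ⟨p, l, r⟩ hx ⟨p', l', r'⟩ hy hxy
      simp only [coe_filter, mem_product, Set.mem_ofPred_eq] at hx hy
      simp only [Prod.mk.injEq] at hxy
      obtain ⟨rfl, rfl⟩ := hxy
      have hr : r * (p * l) = r' * (p * l) := by rw [← mul_assoc, ← mul_assoc, hx.2, hy.2]
      have hr' := Nat.eq_of_mul_eq_mul_right
        (Nat.mul_pos (hA p hx.1.1).pos (hB l hx.1.2.1).pos) hr
      rw [hr']
  rw [card_product, ← sq] at hcard
  exact_mod_cast hcard.trans (Nat.pow_le_pow_left hω 2)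

open Finset in
lemma sum_inv_mul_le_of_injOn {X M : ℕ} (s : Finset ℕ) (φ : ℕ → ℕ)
    (hφ : ∀ b ∈ s, φ b ∈ Icc 1 X) (hinj : Set.InjOn φ s) :
    ∑ b ∈ s, 1 / ((M : ℝ) * φ b) ≤ 1 / M * (1 + Real.log X) := by
  have hharm : ∑ k ∈ Icc 1 X, 1 / (k : ℝ) ≤ 1 + Real.log X := by
    have := harmonic_le_one_add_log X
    rw [harmonic_eq_sum_Icc] at this
    push_cast at this
    simpa only [one_div] using this
  calc ∑ b ∈ s, 1 / ((M : ℝ) * φ b) = ∑ k ∈ s.image φ, 1 / ((M : ℝ) * k) :=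
        (sum_image (f := fun k : ℕ => 1 / ((M : ℝ) * k)) hinj).symm
    _ ≤ ∑ k ∈ Icc 1 X, 1 / ((M : ℝ) * k) :=
        sum_le_sum_of_subset_of_nonneg (image_subset_iff.mpr hφ) fun _ _ _ => by positivity
    _ = 1 / M * ∑ k ∈ Icc 1 X, 1 / (k : ℝ) := by
        rw [mul_sum]
        exact sum_congr rfl fun k _ => by rw [one_div_mul_one_div]
    _ ≤ _ := by gcongr

open Finset in
lemma sum_one_div_abs_sub_le {X M : ℕ} (hM : 0 < M) {a : ℕ} (ha : a ∈ Icc 1 X) :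
    ∑ b ∈ Icc 1 X, (if a ≠ b ∧ (M : ℤ) ∣ (b : ℤ) - a then 1 / |(a : ℝ) - b| else 0) ≤
      2 / M * (1 + Real.log X) := by
  have ha' := mem_Icc.mp ha
  set s := (Icc 1 X).filter fun b => a ≠ b ∧ (M : ℤ) ∣ (b : ℤ) - a with hs
  have hgt : ∀ b ∈ s.filter (a < ·), ∃ k, b = a + M * k ∧ k ∈ Icc 1 X := by
    intro b hb
    simp only [hs, mem_filter, mem_Icc] at hb
    obtain ⟨⟨hbX, -, hd⟩, hab⟩ := hb
    have hd' : M ∣ b - a := by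
      rw [← Int.natCast_dvd_natCast, Nat.cast_sub hab.le]
      exact hd
    obtain ⟨k, hk⟩ := hd'
    have hk0 : 0 < k := Nat.pos_of_ne_zero fun h0 => by subst h0; omega
    have := Nat.le_mul_of_pos_left k hM
    exact ⟨k, by omega, mem_Icc.mpr ⟨hk0, by omega⟩⟩
  have hlt : ∀ b ∈ s.filter (¬ a < ·), ∃ k, a = b + M * k ∧ k ∈ Icc 1 X := by
    intro b hb
    simp only [hs, mem_filter, mem_Icc] at hb
    obtain ⟨⟨hbX, hne, hd⟩, hab⟩ := hb
    have hd' : M ∣ a - b := by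
      rw [← Int.natCast_dvd_natCast, Nat.cast_sub (by omega), ← neg_sub, dvd_neg]
      exact hd
    obtain ⟨k, hk⟩ := hd'
    have hk0 : 0 < k := Nat.pos_of_ne_zero fun h0 => by subst h0; omega
    have := Nat.le_mul_of_pos_left k hM
    exact ⟨k, by omega, mem_Icc.mpr ⟨hk0, by omega⟩⟩
  choose! φ hφ hφX using hgt
  choose! ψ hψ hψX using hlt
  rw [← sum_filter, ← sum_filter_add_sum_filter_not _ (a < ·)]
  have h₁ : ∑ b ∈ s.filter (a < ·), 1 / |(a : ℝ) - b| ≤ 1 / M * (1 + Real.log X) := by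
    refine le_trans (sum_le_sum fun b hb => ?_) (sum_inv_mul_le_of_injOn _ φ hφX ?_)
    · have : (b : ℝ) = a + M * φ b := by exact_mod_cast hφ b hb
      rw [this, sub_add_cancel_left, abs_neg, abs_of_nonneg (by positivity)]
    · intro b hb c hc hbc
      rw [hφ b hb, hφ c hc, hbc]
  have h₂ : ∑ b ∈ s.filter (¬ a < ·), 1 / |(a : ℝ) - b| ≤ 1 / M * (1 + Real.log X) := by
    refine le_trans (sum_le_sum fun b hb => ?_) (sum_inv_mul_le_of_injOn _ ψ hψX ?_)
    · have : (a : ℝ) = b + M * ψ b := by exact_mod_cast hψ b hb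
      rw [this, add_sub_cancel_left, abs_of_nonneg (by positivity)]
    · intro b hb c hc hbc
      have hb' := hψ b hb
      have hc' := hψ c hc
      rw [hbc] at hb'
      omega
  calc _ ≤ _ := add_le_add h₁ h₂
    _ = _ := by ring

lemma natLog_pow_four_mul_le {δ : ℝ} (hδ : 0 < δ) {X : ℕ} (hX : 1 ≤ X) :
    (Nat.log 2 X : ℝ) ^ 4 * (1 + Real.log X) ≤
      (2 / δ) ^ 4 * (1 + 1 / δ) * (X : ℝ) ^ (5 * δ) := by
  have hX' : (1 : ℝ) ≤ X := by exact_mod_cast hX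
  have hlog : Real.log X ≤ (X : ℝ) ^ δ / δ := Real.log_le_rpow_div (by positivity) hδ
  have hlog0 := Real.log_nonneg hX'
  have hone : 1 ≤ (X : ℝ) ^ δ := Real.one_le_rpow hX' hδ.le
  have hK : (Nat.log 2 X : ℝ) ≤ 2 / δ * (X : ℝ) ^ δ := by
    have h2 : (2 : ℝ) ^ Nat.log 2 X ≤ X := by exact_mod_cast Nat.pow_log_le_self 2 (by omega)
    have h3 := Real.log_le_log (by positivity) h2
    rw [Real.log_pow] at h3
    have h4 := Real.log_two_gt_d9
    have h5 : (0 : ℝ) ≤ Nat.log 2 X := by positivity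
    have h6 : (2 : ℝ) / δ * (X : ℝ) ^ δ = 2 * ((X : ℝ) ^ δ / δ) := by ring
    rw [h6]
    nlinarith
  have hL : 1 + Real.log X ≤ (1 + 1 / δ) * (X : ℝ) ^ δ := by
    have : (1 + 1 / δ) * (X : ℝ) ^ δ = (X : ℝ) ^ δ + (X : ℝ) ^ δ / δ := by ring
    linarith
  have hpow : (X : ℝ) ^ (5 * δ) = ((X : ℝ) ^ δ) ^ 5 := by
    rw [mul_comm, Real.rpow_mul (by positivity)]
    exact_mod_cast Real.rpow_natCast _ 5
  calc (Nat.log 2 X : ℝ) ^ 4 * (1 + Real.log X)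
      ≤ (2 / δ * (X : ℝ) ^ δ) ^ 4 * ((1 + 1 / δ) * (X : ℝ) ^ δ) := by gcongr
    _ = _ := by rw [hpow]; ring

open Finset in
lemma sum_congruent_products_le {A B D : Finset ℕ} {X M : ℕ} (hM : 0 < M)
    (hA : ∀ p ∈ A, p.Prime) (hB : ∀ l ∈ B, l.Prime)
    (hX : ∀ p ∈ A, ∀ l ∈ B, ∀ r ∈ D, r * p * l ∈ Icc 1 X) :
    (∑ p₁ ∈ A, ∑ p₂ ∈ A, ∑ l₁ ∈ B, ∑ l₂ ∈ B, ∑ r₁ ∈ D, ∑ r₂ ∈ D,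
      if l₁ * r₂ * p₂ ≠ l₂ * r₁ * p₁ ∧ (M : ℤ) ∣ ((l₁ : ℤ) * r₂ * p₂ - (l₂ : ℤ) * r₁ * p₁) then
        1 / |(r₁ * p₁ * l₂ : ℝ) - (r₂ * p₂ * l₁ : ℝ)| else (0 : ℝ)) ≤
      (Nat.log 2 X : ℝ) ^ 4 * (X * (2 / M * (1 + Real.log X))) := by
  set g : ℕ → ℕ → ℝ := fun a b =>
    if a ≠ b ∧ (M : ℤ) ∣ (b : ℤ) - a then 1 / |(a : ℝ) - b| else 0 with hg
  have hg0 : ∀ a b, 0 ≤ g a b := fun a b => by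
    simp only [hg]
    split_ifs <;> positivity
  have hreorder : (∑ p₁ ∈ A, ∑ p₂ ∈ A, ∑ l₁ ∈ B, ∑ l₂ ∈ B, ∑ r₁ ∈ D, ∑ r₂ ∈ D,
      if l₁ * r₂ * p₂ ≠ l₂ * r₁ * p₁ ∧ (M : ℤ) ∣ ((l₁ : ℤ) * r₂ * p₂ - (l₂ : ℤ) * r₁ * p₁) then
        1 / |(r₁ * p₁ * l₂ : ℝ) - (r₂ * p₂ * l₁ : ℝ)| else (0 : ℝ)) =
      ∑ p₁ ∈ A, ∑ l₂ ∈ B, ∑ r₁ ∈ D, ∑ p₂ ∈ A, ∑ l₁ ∈ B, ∑ r₂ ∈ D,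
        g (r₁ * p₁ * l₂) (r₂ * p₂ * l₁) := by
    refine sum_congr rfl fun p₁ _ => ?_
    calc _ = ∑ p₂ ∈ A, ∑ l₁ ∈ B, ∑ l₂ ∈ B, ∑ r₁ ∈ D, ∑ r₂ ∈ D,
          g (r₁ * p₁ * l₂) (r₂ * p₂ * l₁) := by
          refine sum_congr rfl fun p₂ _ => sum_congr rfl fun l₁ _ => sum_congr rfl fun l₂ _ =>
            sum_congr rfl fun r₁ _ => sum_congr rfl fun r₂ _ => ?_
          have e₁ : l₁ * r₂ * p₂ = r₂ * p₂ * l₁ := by ring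
          have e₂ : l₂ * r₁ * p₁ = r₁ * p₁ * l₂ := by ring
          have e₃ : (l₁ : ℤ) * r₂ * p₂ = r₂ * p₂ * l₁ := by ring
          have e₄ : (l₂ : ℤ) * r₁ * p₁ = r₁ * p₁ * l₂ := by ring
          simp only [hg, e₁, e₂, e₃, e₄, Nat.cast_mul, ne_comm]
      _ = ∑ p₂ ∈ A, ∑ l₂ ∈ B, ∑ r₁ ∈ D, ∑ l₁ ∈ B, ∑ r₂ ∈ D,
          g (r₁ * p₁ * l₂) (r₂ * p₂ * l₁) := by
          refine sum_congr rfl fun p₂ _ => ?_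
          rw [sum_comm]
          exact sum_congr rfl fun l₂ _ => sum_comm
      _ = _ := by
          rw [sum_comm]
          exact sum_congr rfl fun l₂ _ => sum_comm
  rw [hreorder]
  calc _ ≤ ∑ p₁ ∈ A, ∑ l₂ ∈ B, ∑ r₁ ∈ D,
        (Nat.log 2 X : ℝ) ^ 2 * ∑ b ∈ Icc 1 X, g (r₁ * p₁ * l₂) b := by
        refine sum_le_sum fun p₁ _ => sum_le_sum fun l₂ _ => sum_le_sum fun r₁ _ => ?_
        exact sum_prime_prime_mul_le A B D X hA hB hX _ (hg0 _)
    _ ≤ (Nat.log 2 X : ℝ) ^ 2 *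
        ∑ a ∈ Icc 1 X, (Nat.log 2 X : ℝ) ^ 2 * ∑ b ∈ Icc 1 X, g a b :=
        sum_prime_prime_mul_le A B D X hA hB hX
          (fun a => (Nat.log 2 X : ℝ) ^ 2 * ∑ b ∈ Icc 1 X, g a b)
          fun a => mul_nonneg (by positivity) (sum_nonneg fun b _ => hg0 a b)
    _ ≤ (Nat.log 2 X : ℝ) ^ 2 *
        ∑ a ∈ Icc 1 X, (Nat.log 2 X : ℝ) ^ 2 * (2 / M * (1 + Real.log X)) := by
        gcongr with a ha
        exact sum_one_div_abs_sub_le hM ha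
    _ = _ := by
        rw [sum_const, Nat.card_Icc, nsmul_eq_mul]
        push_cast
        ring


/-- For every `ε > 0` there is a constant `C_ε > 0` such that for all reals
`P, L, R ≥ 1` and every positive integer `M`, the sum over primes `p₁, p₂ ∈ [P,2P]`, primes
`ℓ₁, ℓ₂ ∈ [L,2L]` and positive integers `r₁, r₂ ∈ [R,2R]` with `ℓ₁ r₂ p₂ ≠ ℓ₂ r₁ p₁` and
`ℓ₁ r₂ p₂ ≡ ℓ₂ r₁ p₁ (mod M)` of `1/|r₁ p₁ ℓ₂ − r₂ p₂ ℓ₁|` is at most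
`C_ε ((LPR)^{1+ε}/M + min{L,P,R}^{2+ε}/M)`. -/
theorem statement2 :
    ∀ ε : ℝ, 0 < ε → ∃ C : ℝ, 0 < C ∧
      ∀ P L R : ℝ, 1 ≤ P → 1 ≤ L → 1 ≤ R → ∀ M : ℕ, 0 < M →
        (∑ p₁ ∈ (Finset.Icc ⌈P⌉₊ ⌊2 * P⌋₊).filter Nat.Prime,
         ∑ p₂ ∈ (Finset.Icc ⌈P⌉₊ ⌊2 * P⌋₊).filter Nat.Prime,
         ∑ ℓ₁ ∈ (Finset.Icc ⌈L⌉₊ ⌊2 * L⌋₊).filter Nat.Prime,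
         ∑ ℓ₂ ∈ (Finset.Icc ⌈L⌉₊ ⌊2 * L⌋₊).filter Nat.Prime,
         ∑ r₁ ∈ Finset.Icc ⌈R⌉₊ ⌊2 * R⌋₊,
         ∑ r₂ ∈ Finset.Icc ⌈R⌉₊ ⌊2 * R⌋₊,
           if ℓ₁ * r₂ * p₂ ≠ ℓ₂ * r₁ * p₁ ∧
              (M : ℤ) ∣ ((ℓ₁ : ℤ) * r₂ * p₂ - (ℓ₂ : ℤ) * r₁ * p₁) then
             1 / |(r₁ * p₁ * ℓ₂ : ℝ) - (r₂ * p₂ * ℓ₁ : ℝ)|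
           else (0 : ℝ))
        ≤ C * ((L * P * R) ^ (1 + ε) / M + (min L (min P R)) ^ (2 + ε) / M) := by
  intro ε hε
  have hδ : 0 < ε / 5 := by positivity
  set K : ℝ := (2 / (ε / 5)) ^ 4 * (1 + 1 / (ε / 5)) with hK
  have hK0 : 0 < K := by positivity
  refine ⟨2 * K * 8 ^ (1 + ε), by positivity, fun P L R hP hL hR M hM => ?_⟩
  have hM' : (0 : ℝ) < M := by exact_mod_cast hM
  set X : ℕ := ⌊2 * R⌋₊ * ⌊2 * P⌋₊ * ⌊2 * L⌋₊ with hXdef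
  have hfloor : ∀ t : ℝ, 1 ≤ t → 1 ≤ ⌊2 * t⌋₊ := fun t ht =>
    Nat.le_floor (by push_cast; linarith)
  have hX1 : 1 ≤ X :=
    Nat.mul_pos (Nat.mul_pos (hfloor R hR) (hfloor P hP)) (hfloor L hL)
  have hXle : (X : ℝ) ≤ 8 * (L * P * R) := by
    calc (X : ℝ) = (⌊2 * R⌋₊ : ℝ) * ⌊2 * P⌋₊ * ⌊2 * L⌋₊ := by rw [hXdef]; push_cast; ring
      _ ≤ 2 * R * (2 * P) * (2 * L) := by
          gcongr <;> exact Nat.floor_le (by positivity)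
      _ = _ := by ring
  have hXpos : (0 : ℝ) < X := by exact_mod_cast hX1
  refine (sum_congruent_products_le (X := X) hM (fun p hp => (Finset.mem_filter.mp hp).2)
    (fun l hl => (Finset.mem_filter.mp hl).2) ?_).trans ?_
  · intro p hp l hl r hr
    simp only [Finset.mem_filter, Finset.mem_Icc] at hp hl hr
    have hr0 : 0 < r := lt_of_lt_of_le (Nat.ceil_pos.mpr (by linarith)) hr.1
    exact Finset.mem_Icc.mpr ⟨Nat.mul_pos (Nat.mul_pos hr0 hp.2.pos) hl.2.pos,
      Nat.mul_le_mul (Nat.mul_le_mul hr.2 hp.1.2) hl.1.2⟩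
  · have hlog := natLog_pow_four_mul_le hδ hX1
    rw [mul_div_cancel₀ ε (by norm_num : (5 : ℝ) ≠ 0)] at hlog
    have hmin : 0 ≤ (min L (min P R)) ^ (2 + ε) / M :=
      div_nonneg (Real.rpow_nonneg (le_min (by linarith) (le_min (by linarith) (by linarith))) _)
        hM'.le
    calc (Nat.log 2 X : ℝ) ^ 4 * (X * (2 / M * (1 + Real.log X)))
        = 2 / M * X * ((Nat.log 2 X : ℝ) ^ 4 * (1 + Real.log X)) := by ring
      _ ≤ 2 / M * X * (K * (X : ℝ) ^ ε) := by gcongr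
      _ = 2 * K * (X : ℝ) ^ (1 + ε) / M := by
          rw [Real.rpow_add hXpos, Real.rpow_one]
          ring
      _ ≤ 2 * K * (8 * (L * P * R)) ^ (1 + ε) / M := by gcongr
      _ = 2 * K * 8 ^ (1 + ε) * ((L * P * R) ^ (1 + ε) / M) := by
          rw [Real.mul_rpow (by norm_num) (by positivity)]
          ring
      _ ≤ _ := by
          gcongr
          linarith
end

section
/- Let V and w be smooth functions compactly supported in (0,∞) all of whose derivatives are bounded. There exists a constant C, depending only on V and w, such that the following holds. Let t ≥ 2 be real, let N ≥ 1 and M ≥ 1 be reals, let p₁, p₂, ℓ₁, ℓ₂ be positive integers, and let r₁, r₂ be nonzero integers. For a nonzero integer r, positive integers p, ℓ, and y > 0 define 𝒥(r,p,ℓ,y) = ∫_ℝ x^{−it} e(−yt/x) V(x) e(−rNpx/(M²ℓt)) dx. Then the integral 𝔍 = ∫_ℝ 𝒥(r₁,p₁,ℓ₁,y) \overline{𝒥(r₂,p₂,ℓ₂,y)} w(y) dy satisfies |𝔍| ≤ C · min{ t^{−1}, M²ℓ₁ℓ₂ / ( N |ℓ₁ r₂ p₂ − ℓ₂ r₁ p₁|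 ) }, where when ℓ₁ r₂ p₂ = ℓ₂ r₁ p₁ the second quantity in the minimum is interpreted as +∞. -/
open Complex MeasureTheory

/-- `e(x) = exp(2πix)`. -/
noncomputable def e (x : ℝ) : ℂ := Complex.exp (2 * Real.pi * Complex.I * x)

/-- `x^{-it}` for `x > 0`, i.e. `exp(−it·log x)`. -/
noncomputable def nit (x t : ℝ) : ℂ := Complex.exp (-(Complex.I * (t : ℂ)) * (Real.log x : ℂ))

/-- The oscillatory integral `𝒥(r,p,ℓ,y) = ∫ x^{−it} e(−yt/x) V(x) e(−rNpx/(M²ℓt)) dx`. -/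
noncomputable def Josc (V : ℝ → ℂ) (t N M : ℝ) (r : ℤ) (p ℓ : ℕ) (y : ℝ) : ℂ :=
  ∫ x : ℝ, nit x t * e (-(y * t) / x) * V x *
    e (-((r : ℝ) * N * p * x) / (M ^ 2 * ℓ * t))

/-- Quantitative form of `V` being a `C¹` weight function supported in `(0, β)`. -/
structure IsWeight (V : ℝ → ℂ) (B β : ℝ) : Prop where
  differentiable : Differentiable ℝ V
  eq_zero : ∀ x ∉ Set.Ioo 0 β, V x = 0
  deriv_eq_zero : ∀ x ∉ Set.Ioo 0 β, deriv V x = 0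
  norm_le : ∀ x, ‖V x‖ ≤ B
  norm_deriv_le : ∀ x, ‖deriv V x‖ ≤ B
  norm_le_mul : ∀ x, ‖V x‖ ≤ B * |x|

/-- Quantitative form of `g`, `u * g u` and `u * g' u` decaying at least quadratically. -/
structure IsRapidlyDecaying (g : ℝ → ℂ) (B : ℝ) : Prop where
  differentiable : Differentiable ℝ g
  norm_le : ∀ u, (1 + u ^ 2) * ‖g u‖ ≤ B
  norm_mul_le : ∀ u, (1 + u ^ 2) * (|u| * ‖g u‖) ≤ B
  norm_mul_deriv_le : ∀ u, (1 + u ^ 2) * (|u| * ‖deriv g u‖) ≤ B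

theorem IsWeight.mono {V : ℝ → ℂ} {B B' β : ℝ} (h : IsWeight V B β) (hB : B ≤ B') :
    IsWeight V B' β where
  differentiable := h.differentiable
  eq_zero := h.eq_zero
  deriv_eq_zero := h.deriv_eq_zero
  norm_le x := (h.norm_le x).trans hB
  norm_deriv_le x := (h.norm_deriv_le x).trans hB
  norm_le_mul x := (h.norm_le_mul x).trans (by gcongr)

theorem IsRapidlyDecaying.mono {g : ℝ → ℂ} {B B' : ℝ} (h : IsRapidlyDecaying g B) (hB : B ≤ B') :
    IsRapidlyDecaying g B' where
  differentiable := h.differentiable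
  norm_le u := (h.norm_le u).trans hB
  norm_mul_le u := (h.norm_mul_le u).trans hB
  norm_mul_deriv_le u := (h.norm_mul_deriv_le u).trans hB

theorem deriv_eq_zero_of_eqOn_Iic {V : ℝ → ℂ} (hV : Differentiable ℝ V)
    (h0 : ∀ x ≤ 0, V x = 0) {x : ℝ} (hx : x ≤ 0) : deriv V x = 0 := by
  have h1 : HasDerivWithinAt V (deriv V x) (Set.Iic x) x := (hV x).hasDerivAt.hasDerivWithinAt
  have h2 : HasDerivWithinAt V 0 (Set.Iic x) x :=
    (hasDerivWithinAt_const x (Set.Iic x) (0 : ℂ)).congr (fun y hy => h0 y (le_trans hy hx))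
      (h0 x hx)
  exact (uniqueDiffWithinAt_Iic x).eq_deriv _ h1 h2

theorem exists_isWeight {V : ℝ → ℂ} (hV : ContDiff ℝ 1 V) (hVcs : HasCompactSupport V)
    (hVsupp : Function.support V ⊆ Set.Ioi 0) : ∃ B β : ℝ, 0 < β ∧ IsWeight V B β := by
  have hd : Differentiable ℝ V := hV.differentiable (by norm_num)
  obtain ⟨R, hR⟩ := hVcs.isCompact.isBounded.subset_closedBall 0
  obtain ⟨B₀, hB₀⟩ := hVcs.exists_bound_of_continuous hV.continuous
  obtain ⟨B₁, hB₁⟩ := hVcs.deriv.exists_bound_of_continuous (hV.continuous_deriv le_rfl)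
  have hneg : ∀ x ≤ 0, V x = 0 := fun x hx => by
    by_contra h
    exact absurd (hVsupp h) (by simpa using hx)
  have hlarge : ∀ x, max R 0 + 1 ≤ x → x ∉ tsupport V := fun x hx h => by
    have h1 := hR h
    rw [mem_closedBall_zero_iff, Real.norm_eq_abs] at h1
    linarith [le_abs_self x, le_max_left R 0]
  refine ⟨max B₀ B₁, max R 0 + 1, by positivity, hd, fun x hx => ?_, fun x hx => ?_,
    fun x => (hB₀ x).trans (le_max_left _ _), fun x => (hB₁ x).trans (le_max_right _ _),
    fun x => ?_⟩
  · rcases le_or_gt x 0 with h | h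
    · exact hneg x h
    · exact image_eq_zero_of_notMem_tsupport (hlarge x (not_lt.1 fun h' => hx ⟨h, h'⟩))
  · rcases le_or_gt x 0 with h | h
    · exact deriv_eq_zero_of_eqOn_Iic hd hneg h
    · by_contra h2
      exact hlarge x (not_lt.1 fun h' => hx ⟨h, h'⟩) (support_deriv_subset h2)
  · have h1 := Convex.norm_image_sub_le_of_norm_deriv_le (f := V) (fun x _ => hd x)
      (fun x _ => (hB₁ x).trans (le_max_right B₀ B₁)) convex_univ (Set.mem_univ 0) (Set.mem_univ x)
    simpa [hneg 0 le_rfl] using h1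

theorem SchwartzMap.exists_isRapidlyDecaying (g : SchwartzMap ℝ ℂ) :
    ∃ B, IsRapidlyDecaying g B := by
  have h := fun k n u => SchwartzMap.le_seminorm' ℝ k n g u
  set S := fun k n => SchwartzMap.seminorm ℝ k n g
  have hS : ∀ k n, 0 ≤ S k n := fun k n => apply_nonneg _ _
  refine ⟨S 0 0 + S 1 0 + S 2 0 + S 3 0 + S 1 1 + S 3 1, g.differentiable, fun u => ?_,
    fun u => ?_, fun u => ?_⟩
  all_goals
    have h00 := h 0 0 u
    have h10 := h 1 0 u
    have h20 := h 2 0 u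
    have h30 := h 3 0 u
    have h11 := h 1 1 u
    have h31 := h 3 1 u
    simp only [iteratedDeriv_zero, iteratedDeriv_one, pow_zero, pow_one, one_mul] at *
    have := hS 0 0
    have := hS 1 0
    have := hS 2 0
    have := hS 3 0
    have := hS 1 1
    have := hS 3 1
    rw [← sq_abs]
    simp only [S] at *
    linarith

/-- The phase factor and Fourier weight produced by pairing the points `x` and `x + s`. -/
noncomputable def pairFactor (g : ℝ → ℂ) (t s x : ℝ) : ℂ :=
  Complex.exp (-(I * (t : ℂ)) * ((Real.log x - Real.log (x + s) : ℝ) : ℂ)) *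
    g (t / x - t / (x + s))

/-- The derivative of `pairFactor g t s` away from `0` and `-s`. -/
noncomputable def pairFactorDeriv (g : ℝ → ℂ) (t s x : ℝ) : ℂ :=
  Complex.exp (-(I * (t : ℂ)) * ((Real.log x - Real.log (x + s) : ℝ) : ℂ)) *
    (-I * ((t / x - t / (x + s) : ℝ) : ℂ) * g (t / x - t / (x + s)) +
      ((-(t / x ^ 2) + t / (x + s) ^ 2 : ℝ) : ℂ) * deriv g (t / x - t / (x + s)))

/-- The correlation of `V` with itself at distance `s`. -/
noncomputable def pairWeight (V : ℝ → ℂ) (s x : ℝ) : ℂ := V x * (starRingEnd ℂ) (V (x + s))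

/-- The derivative of `pairWeight V s`. -/
noncomputable def pairWeightDeriv (V : ℝ → ℂ) (s x : ℝ) : ℂ :=
  deriv V x * (starRingEnd ℂ) (V (x + s)) + V x * (starRingEnd ℂ) (deriv V (x + s))

theorem hasDerivAt_pairFactor {g : ℝ → ℂ} (hg : Differentiable ℝ g) (t s : ℝ) {x : ℝ}
    (hx : x ≠ 0) (hxs : x + s ≠ 0) :
    HasDerivAt (pairFactor g t s) (pairFactorDeriv g t s x) x := by
  have hadd : HasDerivAt (fun y : ℝ => y + s) 1 x := (hasDerivAt_id x).add_const s
  have hlog : HasDerivAt (fun y : ℝ => Real.log y - Real.log (y + s)) (1 / x - 1 / (x + s)) x := by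
    refine ((Real.hasDerivAt_log hx).sub (hadd.log hxs)).congr_deriv ?_
    rw [one_div x]
  have harg : HasDerivAt (fun y : ℝ => t / y - t / (y + s))
      (-(t / x ^ 2) + t / (x + s) ^ 2) x := by
    have h1 := ((hasDerivAt_const x t).div (hasDerivAt_id x) hx).sub
      ((hasDerivAt_const x t).div hadd hxs)
    refine h1.congr_deriv ?_
    simp only [id]
    ring
  have hexp := (hlog.ofReal_comp.const_mul (-(I * (t : ℂ)))).cexp
  have hg' := (hg (t / x - t / (x + s))).hasDerivAt.scomp x harg
  refine (hexp.mul hg').congr_deriv ?_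
  simp only [pairFactorDeriv, Function.comp, Complex.real_smul]
  push_cast
  ring

theorem hasDerivAt_pairWeight {V : ℝ → ℂ} (hV : Differentiable ℝ V) (s x : ℝ) :
    HasDerivAt (pairWeight V s) (pairWeightDeriv V s x) x := by
  have h1 : HasDerivAt (fun y => V (y + s)) (deriv V (x + s)) x :=
    (hV (x + s)).hasDerivAt.comp_add_const x s
  exact (hV x).hasDerivAt.mul h1.star

theorem norm_exp_neg_I_mul (t r : ℝ) : ‖Complex.exp (-(I * (t : ℂ)) * (r : ℂ))‖ = 1 := by
  rw [show -(I * (t : ℂ)) * (r : ℂ) = ((-(t * r) : ℝ) : ℂ) * I by push_cast; ring]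
  exact Complex.norm_exp_ofReal_mul_I _

theorem norm_e (x : ℝ) : ‖e x‖ = 1 := by
  rw [e, show 2 * (Real.pi : ℂ) * I * x = ((2 * Real.pi * x : ℝ) : ℂ) * I by push_cast; ring]
  exact Complex.norm_exp_ofReal_mul_I _

theorem norm_nit (x t : ℝ) : ‖nit x t‖ = 1 := norm_exp_neg_I_mul _ _

theorem norm_pairFactor (g : ℝ → ℂ) (t s x : ℝ) :
    ‖pairFactor g t s x‖ = ‖g (t / x - t / (x + s))‖ := by
  rw [pairFactor, norm_mul, norm_exp_neg_I_mul, one_mul]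

theorem HasDerivAt.mul_of_bounded {P Q : ℝ → ℂ} {x K : ℝ} (hP : HasDerivAt P 0 x)
    (hPx : P x = 0) (hQ : ∀ y, ‖Q y‖ ≤ K) : HasDerivAt (fun y => P y * Q y) 0 x := by
  rw [hasDerivAt_iff_isLittleO] at hP ⊢
  simp only [hPx, smul_zero, sub_zero, zero_mul] at hP ⊢
  have hQ' : Q =O[nhds x] (fun _ => (1 : ℝ)) :=
    Asymptotics.IsBigO.of_bound K (Filter.Eventually.of_forall fun y => by simpa using hQ y)
  simpa using (hP.norm_right.mul_isBigO hQ').trans_le (fun y => by simp)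

theorem IsRapidlyDecaying.norm_le' {g : ℝ → ℂ} {B : ℝ} (hg : IsRapidlyDecaying g B) (u : ℝ) :
    ‖g u‖ ≤ B := by
  nlinarith [hg.norm_le u, mul_nonneg (sq_nonneg u) (norm_nonneg (g u))]

/-- The amplitude of the integral over pairs at distance `s`, free of the linear phases. -/
noncomputable def pairKernel (V g : ℝ → ℂ) (t s x : ℝ) : ℂ :=
  pairWeight V s x * pairFactor g t s x

/-- The derivative of `pairKernel V g t s`. -/
noncomputable def pairKernelDeriv (V g : ℝ → ℂ) (t s x : ℝ) : ℂ :=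
  pairWeightDeriv V s x * pairFactor g t s x + pairWeight V s x * pairFactorDeriv g t s x

section Kernel

variable {V g : ℝ → ℂ} {B β : ℝ}

theorem IsWeight.pairWeight_eq_zero (hV : IsWeight V B β) {s x : ℝ}
    (h : ¬(x ∈ Set.Ioo 0 β ∧ x + s ∈ Set.Ioo 0 β)) : pairWeight V s x = 0 := by
  rw [not_and_or] at h
  rcases h with h | h <;> simp [pairWeight, hV.eq_zero _ h]

theorem IsWeight.pairWeightDeriv_eq_zero (hV : IsWeight V B β) {s x : ℝ}
    (h : ¬(x ∈ Set.Ioo 0 β ∧ x + s ∈ Set.Ioo 0 β)) : pairWeightDeriv V s x = 0 := by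
  rw [not_and_or] at h
  rcases h with h | h <;> simp [pairWeightDeriv, hV.eq_zero _ h, hV.deriv_eq_zero _ h]

theorem pairKernel_eq_zero (hV : IsWeight V B β) {t s x : ℝ}
    (h : ¬(x ∈ Set.Ioo 0 β ∧ x + s ∈ Set.Ioo 0 β)) : pairKernel V g t s x = 0 := by
  rw [pairKernel, hV.pairWeight_eq_zero h, zero_mul]

theorem pairKernelDeriv_eq_zero (hV : IsWeight V B β) {t s x : ℝ}
    (h : ¬(x ∈ Set.Ioo 0 β ∧ x + s ∈ Set.Ioo 0 β)) : pairKernelDeriv V g t s x = 0 := by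
  rw [pairKernelDeriv, hV.pairWeight_eq_zero h, hV.pairWeightDeriv_eq_zero h, zero_mul, zero_mul,
    add_zero]

theorem hasDerivAt_pairKernel (hV : IsWeight V B β) (hg : IsRapidlyDecaying g B) (t s x : ℝ) :
    HasDerivAt (pairKernel V g t s) (pairKernelDeriv V g t s x) x := by
  by_cases h : x ∈ Set.Ioo 0 β ∧ x + s ∈ Set.Ioo 0 β
  · exact (hasDerivAt_pairWeight hV.differentiable s x).mul
      (hasDerivAt_pairFactor hg.differentiable t s h.1.1.ne' h.2.1.ne')
  · rw [pairKernelDeriv_eq_zero hV h]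
    have h1 := hasDerivAt_pairWeight hV.differentiable s x
    rw [hV.pairWeightDeriv_eq_zero h] at h1
    exact h1.mul_of_bounded (hV.pairWeight_eq_zero h) (K := B) fun y =>
      (norm_pairFactor g t s y).trans_le (hg.norm_le' _)

theorem sq_div_le_sq_div_sub_div (t : ℝ) {s x : ℝ}
    (hx : x ∈ Set.Ioo 0 β) (hxs : x + s ∈ Set.Ioo 0 β) :
    (t / β ^ 2 * s) ^ 2 ≤ (t / x - t / (x + s)) ^ 2 := by
  obtain ⟨hx0, hx1⟩ := hx
  obtain ⟨hs0, hs1⟩ := hxs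
  have hu : t / x - t / (x + s) = t * s / (x * (x + s)) := by
    field_simp
    ring
  have hβ : 0 < β := hx0.trans hx1
  rw [hu, sq_le_sq, show t / β ^ 2 * s = t * s / β ^ 2 by ring, abs_div, abs_div,
    abs_of_pos (pow_pos hβ 2), abs_of_pos (mul_pos hx0 hs0)]
  gcongr
  nlinarith

theorem norm_pairKernel_le (hB : 0 ≤ B) (hV : IsWeight V B β) (hg : IsRapidlyDecaying g B)
    (t s x : ℝ) : ‖pairKernel V g t s x‖ ≤ 5 * B ^ 3 * (1 + (t / β ^ 2 * s) ^ 2)⁻¹ := by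
  by_cases h : x ∈ Set.Ioo 0 β ∧ x + s ∈ Set.Ioo 0 β
  swap
  · rw [pairKernel_eq_zero hV h, norm_zero]
    positivity
  have hu := sq_div_le_sq_div_sub_div t h.1 h.2
  rw [← div_eq_mul_inv, le_div_iff₀' (by positivity), pairKernel, pairWeight, norm_mul, norm_mul,
    norm_pairFactor, RCLike.norm_conj]
  set u := t / x - t / (x + s)
  calc (1 + (t / β ^ 2 * s) ^ 2) * (‖V x‖ * ‖V (x + s)‖ * ‖g u‖)
      ≤ (1 + u ^ 2) * (‖V x‖ * ‖V (x + s)‖ * ‖g u‖) := by gcongr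
    _ = ‖V x‖ * ‖V (x + s)‖ * ((1 + u ^ 2) * ‖g u‖) := by ring
    _ ≤ B * B * B := by
        gcongr
        exacts [hV.norm_le _, hV.norm_le _, hg.norm_le _]
    _ ≤ 5 * B ^ 3 := by nlinarith [pow_nonneg hB 3]

theorem norm_pairKernelDeriv_le (hB : 0 ≤ B) (hV : IsWeight V B β) (hg : IsRapidlyDecaying g B)
    (t s x : ℝ) : ‖pairKernelDeriv V g t s x‖ ≤ 5 * B ^ 3 * (1 + (t / β ^ 2 * s) ^ 2)⁻¹ := by
  by_cases h : x ∈ Set.Ioo 0 β ∧ x + s ∈ Set.Ioo 0 β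
  swap
  · rw [pairKernelDeriv_eq_zero hV h, norm_zero]
    positivity
  have hu := sq_div_le_sq_div_sub_div t h.1 h.2
  rw [← div_eq_mul_inv, le_div_iff₀' (by positivity)]
  have hx0 : 0 < x := h.1.1
  have hs0 : 0 < x + s := h.2.1
  have hfac : -(t / x ^ 2) + t / (x + s) ^ 2
      = -((t / x - t / (x + s)) * (1 / x + 1 / (x + s))) := by
    field_simp
    ring
  have hVx : ‖V x‖ * (1 / x) ≤ B := by
    rw [mul_one_div, div_le_iff₀ hx0]
    simpa [abs_of_pos hx0] using hV.norm_le_mul x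
  have hVs : ‖V (x + s)‖ * (1 / (x + s)) ≤ B := by
    rw [mul_one_div, div_le_iff₀ hs0]
    simpa [abs_of_pos hs0] using hV.norm_le_mul (x + s)
  have hW : ‖pairWeight V s x‖ = ‖V x‖ * ‖V (x + s)‖ := by
    rw [pairWeight, norm_mul, RCLike.norm_conj]
  have hW' : ‖pairWeightDeriv V s x‖ ≤ 2 * B ^ 2 := by
    refine (norm_add_le _ _).trans ?_
    simp only [norm_mul, RCLike.norm_conj]
    nlinarith [mul_le_mul (hV.norm_deriv_le x) (hV.norm_le (x + s)) (norm_nonneg _) hB,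
      mul_le_mul (hV.norm_le x) (hV.norm_deriv_le (x + s)) (norm_nonneg _) hB]
  have hF : ‖pairFactorDeriv g t s x‖ ≤ |t / x - t / (x + s)| * ‖g (t / x - t / (x + s))‖ +
      |t / x - t / (x + s)| * (1 / x + 1 / (x + s)) * ‖deriv g (t / x - t / (x + s))‖ := by
    rw [pairFactorDeriv, norm_mul, norm_exp_neg_I_mul, one_mul, hfac]
    refine (norm_add_le _ _).trans (le_of_eq ?_)
    rw [norm_mul, norm_mul, norm_mul, norm_neg, norm_I, one_mul, Complex.norm_real,
      Complex.norm_real, Real.norm_eq_abs, Real.norm_eq_abs, abs_neg, abs_mul,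
      abs_of_pos (by positivity : 0 < 1 / x + 1 / (x + s))]
  set u := t / x - t / (x + s)
  have hgu := hg.norm_le u
  calc (1 + (t / β ^ 2 * s) ^ 2) * ‖pairKernelDeriv V g t s x‖
      ≤ (1 + u ^ 2) * (2 * B ^ 2 * ‖g u‖ + ‖V x‖ * ‖V (x + s)‖ *
          (|u| * ‖g u‖ + |u| * (1 / x + 1 / (x + s)) * ‖deriv g u‖)) := by
        gcongr
        refine (norm_add_le _ _).trans ?_
        rw [norm_mul, norm_mul, norm_pairFactor, hW]
        gcongr
    _ = 2 * B ^ 2 * ((1 + u ^ 2) * ‖g u‖) +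
          ‖V x‖ * ‖V (x + s)‖ * ((1 + u ^ 2) * (|u| * ‖g u‖)) +
          ((‖V x‖ * (1 / x)) * ‖V (x + s)‖ + ‖V x‖ * (‖V (x + s)‖ * (1 / (x + s)))) *
            ((1 + u ^ 2) * (|u| * ‖deriv g u‖)) := by ring
    _ ≤ 2 * B ^ 2 * B + B * B * B + (B * B + B * B) * B := by
        gcongr
        exacts [hV.norm_le _, hV.norm_le _, hg.norm_mul_le _, hV.norm_le _, hV.norm_le _,
          hg.norm_mul_deriv_le _]
    _ = 5 * B ^ 3 := by ring

theorem integrable_of_norm_le_of_eq_zero {f : ℝ → ℂ} {K : ℝ} (hf : Measurable f)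
    (hK : ∀ x, ‖f x‖ ≤ K) (h0 : ∀ x ∉ Set.Ioo 0 β, f x = 0) : Integrable f := by
  refine Measure.integrableOn_of_bounded (M := K) (s := Set.Ioo 0 β) (by simp)
    hf.aestronglyMeasurable (Filter.Eventually.of_forall hK)
    |>.integrable_of_forall_notMem_eq_zero h0

theorem norm_integral_le_of_eq_zero {f : ℝ → ℂ} {K : ℝ} (hβ : 0 ≤ β)
    (hK : ∀ x, ‖f x‖ ≤ K) (h0 : ∀ x ∉ Set.Ioo 0 β, f x = 0) : ‖∫ x, f x‖ ≤ β * K := by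
  rw [← setIntegral_eq_integral_of_forall_compl_eq_zero h0]
  refine (norm_setIntegral_le_of_norm_le_const (by simp) fun x _ => hK x).trans (le_of_eq ?_)
  simp [Measure.real, hβ, mul_comm]

theorem continuous_e : Continuous e := by
  unfold e
  fun_prop

theorem hasDerivAt_e_mul (c x : ℝ) :
    HasDerivAt (fun y => e (c * y)) (2 * Real.pi * I * c * e (c * x)) x := by
  have h1 : HasDerivAt (fun y : ℝ => ((c * y : ℝ) : ℂ)) ((c * 1 : ℝ) : ℂ) x :=
    ((hasDerivAt_id x).const_mul c).ofReal_comp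
  refine (h1.const_mul (2 * Real.pi * I)).cexp.congr_deriv ?_
  rw [e]
  push_cast
  ring

theorem norm_integral_e_mul_pairKernel_le (hβ : 0 ≤ β) (hB : 0 ≤ B) (hV : IsWeight V B β)
    (hg : IsRapidlyDecaying g B) (t s c : ℝ) :
    ‖∫ x, e (c * x) * pairKernel V g t s x‖ ≤ β * (5 * B ^ 3 * (1 + (t / β ^ 2 * s) ^ 2)⁻¹) := by
  refine norm_integral_le_of_eq_zero hβ (fun x => ?_) fun x hx => ?_
  · rw [norm_mul, norm_e, one_mul]
    exact norm_pairKernel_le hB hV hg t s x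
  · rw [pairKernel_eq_zero hV fun h => hx h.1, mul_zero]

theorem abs_mul_norm_integral_e_mul_pairKernel_le (hβ : 0 ≤ β) (hB : 0 ≤ B) (hV : IsWeight V B β)
    (hg : IsRapidlyDecaying g B) (t s c : ℝ) :
    |c| * ‖∫ x, e (c * x) * pairKernel V g t s x‖ ≤
      β * (5 * B ^ 3 * (1 + (t / β ^ 2 * s) ^ 2)⁻¹) := by
  have hk := hasDerivAt_pairKernel hV hg t s
  have hkm : Measurable (pairKernel V g t s) :=
    (Differentiable.continuous fun x => (hk x).differentiableAt).measurable
  have hkd : Measurable (pairKernelDeriv V g t s) := by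
    rw [← funext fun x => (hk x).deriv]
    exact measurable_deriv _
  have hem : Measurable fun x => e (c * x) := (continuous_e.comp (by fun_prop)).measurable
  have hik : Integrable (fun x => pairKernel V g t s x * e (c * x)) := by
    refine integrable_of_norm_le_of_eq_zero (β := β)
      (K := 5 * B ^ 3 * (1 + (t / β ^ 2 * s) ^ 2)⁻¹) (hkm.mul hem) (fun x => ?_) fun x hx => ?_
    · rw [norm_mul, norm_e, mul_one]
      exact norm_pairKernel_le hB hV hg t s x
    · rw [pairKernel_eq_zero hV fun h => hx h.1, zero_mul]
  have hbound : ∀ x, ‖pairKernelDeriv V g t s x * e (c * x)‖ ≤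
      5 * B ^ 3 * (1 + (t / β ^ 2 * s) ^ 2)⁻¹ := fun x => by
    rw [norm_mul, norm_e, mul_one]
    exact norm_pairKernelDeriv_le hB hV hg t s x
  have hzero : ∀ x ∉ Set.Ioo 0 β, pairKernelDeriv V g t s x * e (c * x) = 0 := fun x hx => by
    rw [pairKernelDeriv_eq_zero hV fun h => hx h.1, zero_mul]
  have hid : Integrable (fun x => pairKernelDeriv V g t s x * e (c * x)) :=
    integrable_of_norm_le_of_eq_zero (hkd.mul hem) hbound hzero
  have hibp := integral_mul_deriv_eq_deriv_mul_of_integrable (u := pairKernel V g t s)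
    (v := fun x => e (c * x)) (fun x _ => hk x) (fun x _ => hasDerivAt_e_mul c x)
    (by
      refine (hik.const_mul (2 * Real.pi * I * c)).congr (Filter.Eventually.of_forall fun x => ?_)
      simp only [Pi.mul_apply]
      ring) hid hik
  have hfactor : ∫ x, pairKernel V g t s x * (2 * Real.pi * I * c * e (c * x)) =
      2 * Real.pi * I * c * ∫ x, e (c * x) * pairKernel V g t s x := by
    rw [← integral_const_mul]
    congr 1 with x
    ring
  have hnorm := norm_integral_le_of_eq_zero hβ hbound hzero
  rw [← norm_neg, ← hibp, hfactor, norm_mul, norm_mul, norm_mul, norm_mul, norm_I,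
    Complex.norm_real, Complex.norm_real, Real.norm_eq_abs, Real.norm_eq_abs,
    abs_of_pos Real.pi_pos, Complex.norm_ofNat, mul_one] at hnorm
  refine le_trans ?_ hnorm
  gcongr
  nlinarith [Real.pi_gt_three, abs_nonneg c]

theorem norm_iterated_integral_le {F : ℝ → ℂ} {A t : ℝ} (hβ : 0 < β) (ht : 0 < t)
    (hF : ∀ s, ‖F s‖ ≤ β * (A * (1 + (t / β ^ 2 * s) ^ 2)⁻¹)) :
    ‖∫ s, F s‖ ≤ β ^ 3 * A * Real.pi * t⁻¹ := by
  have hc : 0 < t / β ^ 2 := by positivity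
  have hi : Integrable fun s : ℝ => (1 + (t / β ^ 2 * s) ^ 2)⁻¹ :=
    integrable_inv_one_add_sq.comp_mul_left' hc.ne'
  refine (norm_integral_le_of_norm_le ((hi.const_mul A).const_mul β)
    (Filter.Eventually.of_forall hF)).trans (le_of_eq ?_)
  rw [integral_const_mul, integral_const_mul,
    Measure.integral_comp_mul_left (fun x : ℝ => (1 + x ^ 2)⁻¹), integral_univ_inv_one_add_sq,
    abs_of_pos (inv_pos.2 hc), smul_eq_mul]
  field_simp

end Kernel

/-- The integral `∫ x^{-it} e(-yt/x) V(x) e(-ax) dx`. -/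
noncomputable def oscIntegral (V : ℝ → ℂ) (t a y : ℝ) : ℂ :=
  ∫ x : ℝ, nit x t * e (-(y * t) / x) * V x * e (-(a * x))

theorem Josc_eq_oscIntegral (V : ℝ → ℂ) (t N M : ℝ) (r : ℤ) (p ℓ : ℕ) (y : ℝ) :
    Josc V t N M r p ℓ y = oscIntegral V t (r * N * p / (M ^ 2 * ℓ * t)) y := by
  unfold Josc oscIntegral
  congr 1 with x
  congr 2
  ring

theorem e_add (x y : ℝ) : e (x + y) = e x * e y := by
  rw [e, e, e, ← Complex.exp_add]
  push_cast
  ring_nf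

theorem conj_e (x : ℝ) : (starRingEnd ℂ) (e x) = e (-x) := by
  rw [e, e, ← Complex.exp_conj]
  simp [Complex.conj_ofNat]

theorem conj_nit (x t : ℝ) :
    (starRingEnd ℂ) (nit x t) = Complex.exp (I * (t : ℂ) * (Real.log x : ℂ)) := by
  rw [nit, ← Complex.exp_conj]
  simp

section Fubini

variable {V w : ℝ → ℂ} {t : ℝ}

/-- The integrand obtained by expanding the correlation of two `oscIntegral`s. -/
noncomputable def tripleIntegrand (V w : ℝ → ℂ) (t a₁ a₂ y : ℝ) (z : ℝ × ℝ) : ℂ :=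
  nit z.1 t * e (-(y * t) / z.1) * V z.1 * e (-(a₁ * z.1)) *
    (starRingEnd ℂ) (nit z.2 t * e (-(y * t) / z.2) * V z.2 * e (-(a₂ * z.2))) * w y

theorem integral_tripleIntegrand_right (a₁ a₂ y : ℝ) :
    ∫ z, tripleIntegrand V w t a₁ a₂ y z =
      oscIntegral V t a₁ y * (starRingEnd ℂ) (oscIntegral V t a₂ y) * w y := by
  simp only [tripleIntegrand]
  rw [integral_mul_const, Measure.volume_eq_prod, oscIntegral, oscIntegral, ← integral_conj,
    ← integral_prod_mul]

theorem integrable_tripleIntegrand (hV : Integrable V) (hVm : Measurable V) (hw : Integrable w)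
    (hwm : Measurable w) (a₁ a₂ : ℝ) :
    Integrable (Function.uncurry (tripleIntegrand V w t a₁ a₂)) (volume.prod volume) := by
  have he : Measurable e := continuous_e.measurable
  have hn : Measurable fun x => nit x t := by
    unfold nit
    fun_prop
  refine (hw.norm.mul_prod (hV.norm.mul_prod hV.norm)).mono' (Measurable.aestronglyMeasurable ?_)
    (Filter.Eventually.of_forall fun z => le_of_eq ?_)
  · have hconj : Measurable (starRingEnd ℂ) := Complex.continuous_conj.measurable
    unfold Function.uncurry tripleIntegrand
    fun_prop
  · simp only [Function.uncurry, tripleIntegrand, norm_mul, RCLike.norm_conj, norm_e, norm_nit]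
    ring

open scoped FourierTransform in
theorem integral_tripleIntegrand_left (a₁ a₂ x s : ℝ) :
    ∫ y, tripleIntegrand V w t a₁ a₂ y (x, x + s) =
      e (a₂ * s) * (e ((a₂ - a₁) * x) * pairKernel V (𝓕 w) t s x) := by
  have h : ∀ y, tripleIntegrand V w t a₁ a₂ y (x, x + s) =
      e (a₂ * s) * (e ((a₂ - a₁) * x) * (pairWeight V s x *
        Complex.exp (-(I * (t : ℂ)) * ((Real.log x - Real.log (x + s) : ℝ) : ℂ)))) *
        (Complex.exp (((-2 * Real.pi * y * (t / x - t / (x + s)) : ℝ) : ℂ) * I) • w y) := fun y => by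
    have h1 : Complex.exp (-(I * (t : ℂ)) * ((Real.log x - Real.log (x + s) : ℝ) : ℂ)) =
        nit x t * (starRingEnd ℂ) (nit (x + s) t) := by
      rw [conj_nit, nit, ← Complex.exp_add]
      push_cast
      ring_nf
    have h2 : Complex.exp (((-2 * Real.pi * y * (t / x - t / (x + s)) : ℝ) : ℂ) * I) =
        e (-(y * t) / x) * e (-(-(y * t) / (x + s))) := by
      rw [← e_add, e]
      push_cast
      ring_nf
    have h3 : e (a₂ * s) * e ((a₂ - a₁) * x) = e (-(a₁ * x)) * e (-(-(a₂ * (x + s)))) := by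
      rw [← e_add, ← e_add]
      ring_nf
    simp only [tripleIntegrand, map_mul, conj_e, h1, h2, pairWeight, smul_eq_mul]
    linear_combination (-(V x * (starRingEnd ℂ) (V (x + s)) * (nit x t *
      (starRingEnd ℂ) (nit (x + s) t)) * (e (-(y * t) / x) * e (-(-(y * t) / (x + s)))) * w y)) * h3
  simp_rw [h]
  rw [integral_const_mul, ← Real.fourier_real_eq_integral_exp_smul, pairKernel, pairFactor]
  ring

open scoped FourierTransform in
theorem integral_oscIntegral_eq (hV : Integrable V) (hVm : Measurable V) (hw : Integrable w)
    (hwm : Measurable w) (a₁ a₂ : ℝ) :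
    ∫ y, oscIntegral V t a₁ y * (starRingEnd ℂ) (oscIntegral V t a₂ y) * w y =
      ∫ s, e (a₂ * s) * ∫ x, e ((a₂ - a₁) * x) * pairKernel V (𝓕 w) t s x := by
  have hint := integrable_tripleIntegrand (t := t) hV hVm hw hwm a₁ a₂
  have hmp := measurePreserving_prod_add (volume : Measure ℝ) (volume : Measure ℝ)
  have hme : MeasurableEmbedding fun z : ℝ × ℝ => (z.1, z.1 + z.2) :=
    (MeasurableEquiv.shearAddRight ℝ).measurableEmbedding
  simp_rw [← integral_tripleIntegrand_right]
  have hcomp : Integrable (fun z : ℝ × ℝ => ∫ y, tripleIntegrand V w t a₁ a₂ y (z.1, z.1 + z.2))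
      (volume.prod volume) := (hmp.integrable_comp_emb hme).2 hint.integral_prod_right
  rw [integral_integral_swap hint, Measure.volume_eq_prod, ← hmp.integral_comp hme,
    integral_prod_symm _ hcomp]
  simp_rw [integral_tripleIntegrand_left, integral_const_mul]

end Fubini

theorem exists_bound_integral_oscIntegral {V w : ℝ → ℂ} (hV : ContDiff ℝ 1 V)
    (hVcs : HasCompactSupport V) (hVsupp : Function.support V ⊆ Set.Ioi 0)
    (hw : ContDiff ℝ (⊤ : ℕ∞) w) (hwcs : HasCompactSupport w) :
    ∃ C : ℝ, 0 < C ∧ ∀ t : ℝ, 0 < t → ∀ a₁ a₂ : ℝ,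
      ‖∫ y, oscIntegral V t a₁ y * (starRingEnd ℂ) (oscIntegral V t a₂ y) * w y‖ ≤ C * t⁻¹ ∧
      |a₂ - a₁| * ‖∫ y, oscIntegral V t a₁ y * (starRingEnd ℂ) (oscIntegral V t a₂ y) * w y‖ ≤
        C * t⁻¹ := by
  obtain ⟨B₁, β, hβ, hV₁⟩ := exists_isWeight hV hVcs hVsupp
  obtain ⟨B₂, hg₂⟩ :=
    (FourierTransform.fourier (hwcs.toSchwartzMap hw)).exists_isRapidlyDecaying
  set B := max 1 (max B₁ B₂)
  have hB : 0 < B := lt_max_of_lt_left one_pos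
  have hVB : IsWeight V B β := hV₁.mono ((le_max_left _ _).trans (le_max_right _ _))
  have hgB : IsRapidlyDecaying (FourierTransform.fourier w) B :=
    IsRapidlyDecaying.mono hg₂ ((le_max_right _ _).trans (le_max_right _ _))
  have hVi : Integrable V := hV.continuous.integrable_of_hasCompactSupport hVcs
  have hwi : Integrable w := hw.continuous.integrable_of_hasCompactSupport hwcs
  refine ⟨β ^ 3 * (5 * B ^ 3) * Real.pi, by positivity, fun t ht a₁ a₂ => ?_⟩
  rw [integral_oscIntegral_eq hVi hV.continuous.measurable hwi hw.continuous.measurable]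
  constructor
  · refine norm_iterated_integral_le hβ ht fun s => ?_
    rw [norm_mul, norm_e, one_mul]
    exact norm_integral_e_mul_pairKernel_le hβ.le hB.le hVB hgB t s _
  · rw [← abs_abs (a₂ - a₁), ← Real.norm_eq_abs |a₂ - a₁|, ← Complex.norm_real, ← norm_mul,
      ← integral_const_mul]
    refine norm_iterated_integral_le hβ ht fun s => ?_
    rw [norm_mul, norm_mul, norm_e, one_mul, Complex.norm_real, Real.norm_eq_abs, abs_abs]
    exact abs_mul_norm_integral_e_mul_pairKernel_le hβ.le hB.le hVB hgB t s _

/-- **Lemma on the integral 𝔍.** Let `V, w` be smooth, compactly supported in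
`(0,∞)`, with all derivatives bounded. There is `C = C(V,w)` such that for all `t ≥ 2`,
`N, M ≥ 1`, positive integers `p₁,p₂,ℓ₁,ℓ₂` and nonzero integers `r₁,r₂`, the integral
`𝔍 = ∫ 𝒥(r₁,p₁,ℓ₁,y) conj(𝒥(r₂,p₂,ℓ₂,y)) w(y) dy` satisfies
`|𝔍| ≤ C·min{t^{−1}, M²ℓ₁ℓ₂/(N|ℓ₁r₂p₂ − ℓ₂r₁p₁|)}` (the second bound when
`ℓ₁r₂p₂ ≠ ℓ₂r₁p₁`; it is `+∞` otherwise). -/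
theorem statement3 (V w : ℝ → ℂ)
    (hVsm : ContDiff ℝ (⊤ : ℕ∞) V) (hVcs : HasCompactSupport V)
    (hVsupp : Function.support V ⊆ Set.Ioi 0)
    (hVder : ∀ j : ℕ, ∃ Cj : ℝ, ∀ x : ℝ, ‖iteratedDeriv j V x‖ ≤ Cj)
    (hwsm : ContDiff ℝ (⊤ : ℕ∞) w) (hwcs : HasCompactSupport w)
    (hwsupp : Function.support w ⊆ Set.Ioi 0)
    (hwder : ∀ j : ℕ, ∃ Cj : ℝ, ∀ x : ℝ, ‖iteratedDeriv j w x‖ ≤ Cj) :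
    ∃ C : ℝ, 0 < C ∧
      ∀ t : ℝ, 2 ≤ t → ∀ N M : ℝ, 1 ≤ N → 1 ≤ M →
        ∀ p₁ p₂ ℓ₁ ℓ₂ : ℕ, 0 < p₁ → 0 < p₂ → 0 < ℓ₁ → 0 < ℓ₂ →
          ∀ r₁ r₂ : ℤ, r₁ ≠ 0 → r₂ ≠ 0 →
            ‖∫ y : ℝ, Josc V t N M r₁ p₁ ℓ₁ y *
                (starRingEnd ℂ) (Josc V t N M r₂ p₂ ℓ₂ y) * w y‖ ≤ C * t⁻¹ ∧
            ((ℓ₁ : ℤ) * r₂ * p₂ ≠ (ℓ₂ : ℤ) * r₁ * p₁ →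
              ‖∫ y : ℝ, Josc V t N M r₁ p₁ ℓ₁ y *
                  (starRingEnd ℂ) (Josc V t N M r₂ p₂ ℓ₂ y) * w y‖
                ≤ C * (M ^ 2 * ℓ₁ * ℓ₂) /
                    (N * |(ℓ₁ : ℝ) * r₂ * p₂ - (ℓ₂ : ℝ) * r₁ * p₁|)) := by
  obtain ⟨C, hC, h⟩ := exists_bound_integral_oscIntegral (hVsm.of_le (mod_cast le_top)) hVcs hVsupp
    hwsm hwcs
  refine ⟨C, hC, fun t ht N M hN hM p₁ p₂ ℓ₁ ℓ₂ _ _ hℓ₁ hℓ₂ r₁ r₂ _ _ => ?_⟩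
  have ht0 : 0 < t := by linarith
  simp_rw [Josc_eq_oscIntegral]
  obtain ⟨h1, h2⟩ := h t ht0 (r₁ * N * p₁ / (M ^ 2 * ℓ₁ * t)) (r₂ * N * p₂ / (M ^ 2 * ℓ₂ * t))
  refine ⟨h1, fun hne => ?_⟩
  have hD : 0 < |(ℓ₁ : ℝ) * r₂ * p₂ - (ℓ₂ : ℝ) * r₁ * p₁| :=
    abs_pos.2 (sub_ne_zero.2 (mod_cast hne))
  have hℓ₁' : (0 : ℝ) < ℓ₁ := mod_cast hℓ₁
  have hℓ₂' : (0 : ℝ) < ℓ₂ := mod_cast hℓ₂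
  have hN0 : 0 < N := by linarith
  have hM0 : 0 < M := by linarith
  have hdiff : (r₂ * N * p₂ / (M ^ 2 * ℓ₂ * t) - r₁ * N * p₁ / (M ^ 2 * ℓ₁ * t) : ℝ) =
      N / (M ^ 2 * ℓ₁ * ℓ₂ * t) * ((ℓ₁ : ℝ) * r₂ * p₂ - (ℓ₂ : ℝ) * r₁ * p₁) := by
    field_simp
  rw [hdiff, abs_mul, abs_of_pos (by positivity : 0 < N / (M ^ 2 * ℓ₁ * ℓ₂ * t))] at h2
  rw [le_div_iff₀ (by positivity)]
  have h3 := mul_le_mul_of_nonneg_left h2 (by positivity : 0 ≤ M ^ 2 * ℓ₁ * ℓ₂ * t)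
  refine le_of_eq_of_le ?_ (h3.trans_eq ?_)
  · field_simp
  · field_simp
end
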